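/- arXiv:2409.14806 — 4 statements merged into one kernel-verified Lean document; each statement's English description precedes it below -/
import Mathlib

section
/- Let π be a probability measure on ℝ with π0 = π((−∞, 0]) > 0 and π1 = π((0, ∞)) > 0, and let g : ℝ × [0, 1] → [0, ∞) be jointly measurable with ∫_0^1 g(θ, p) dp = 1 for every θ, such that for every θ ≤ 0 the map p ↦ g(θ, p) is monotone nondecreasing on [0,1], for every θ > 0 the map p ↦ g(θ, p) is monotone nonincreasing on [0,1], and g(0, p) = 1 for all p ∈ [0, 1]. Define BF(p) = (∫_{(0,∞)} g(θ, p) dπ(θ)/π1) / (∫_{(−∞,0]} g(θ, p) dπ(θ)/π0), and assume the denominator is strictly positive for all p and BF is integrable under every g(θ0, ·) with θ0 ≤ 0. Then for every θ0 ≤ 0, ∫_0^1 BF(p) g(θ0, p) dp ≤ ∫_0^1 BF(p) dp; that is, the supremum over the null hypothesis of the expected Bayes factor, μ* = sup_{θ0 ≤ 0} E_{θ0}[BF], equals E_0[BF]. -/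
open MeasureTheory
open scoped ENNReal

theorem ENNReal.mul_add_mul_le_mul_add_mul_of_le {a b c d : ℝ≥0∞} (hba : b ≤ a) (hcd : c ≤ d) :
    a * c + b * d ≤ a * d + b * c := by
  obtain ⟨u, rfl⟩ := exists_add_of_le hba
  obtain ⟨v, rfl⟩ := exists_add_of_le hcd
  calc (b + u) * c + b * (c + v) ≤ (b + u) * c + b * (c + v) + u * v := le_self_add
    _ = (b + u) * (c + v) + b * c := by ring

/-- Chebyshev's integral inequality for an antitone and a monotone function on a set. -/
theorem AntitoneOn.lintegral_mul_mul_measure_le {α : Type*} [LinearOrder α] [MeasurableSpace α]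
    {μ : Measure α} {s : Set α} (hs : MeasurableSet s) {f h : α → ℝ≥0∞}
    (hf : AntitoneOn f s) (hh : MonotoneOn h s)
    (hfm : AEMeasurable f (μ.restrict s)) (hhm : AEMeasurable h (μ.restrict s)) :
    (∫⁻ x in s, f x * h x ∂μ) * μ s ≤ (∫⁻ x in s, f x ∂μ) * ∫⁻ x in s, h x ∂μ := by
  have hpt : ∀ x ∈ s, ∀ y ∈ s, f x * h x + f y * h y ≤ f x * h y + f y * h x := by
    intro x hx y hy
    rcases le_total x y with hxy | hxy
    · exact ENNReal.mul_add_mul_le_mul_add_mul_of_le (hf hx hy hxy) (hh hx hy hxy)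
    · rw [add_comm, add_comm (f x * h y)]
      exact ENNReal.mul_add_mul_le_mul_add_mul_of_le (hf hy hx hxy) (hh hy hx hxy)
  have hinner : ∀ x ∈ s, f x * h x * μ s + ∫⁻ y in s, f y * h y ∂μ ≤
      f x * (∫⁻ y in s, h y ∂μ) + (∫⁻ y in s, f y ∂μ) * h x := by
    intro x hx
    have hle := setLIntegral_mono' (μ := μ) hs (hpt x hx)
    rwa [lintegral_add_left measurable_const, setLIntegral_const,
      lintegral_add_left' (hhm.const_mul _), lintegral_const_mul'' _ hhm,
      lintegral_mul_const'' _ hfm] at hle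
  have houter := setLIntegral_mono' (μ := μ) hs hinner
  rw [lintegral_add_right _ measurable_const, setLIntegral_const,
    lintegral_mul_const'' (f := fun x ↦ f x * h x) _ (hfm.mul hhm),
    lintegral_add_left' (hfm.mul_const _),
    lintegral_mul_const'' _ hfm, lintegral_const_mul'' _ hhm, ← two_mul, ← two_mul] at houter
  exact (ENNReal.mul_le_mul_iff_right two_ne_zero ENNReal.ofNat_ne_top).1 houter

/-- Lemma A.2 of Hoang and Dickhaus (Example 2 of the paper): under the monotonicity
conditions (5)–(6) for densities on `[0,1]` with `g 0` the uniform density, the expected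
Bayes factor under any null parameter `θ0 ≤ 0` is bounded by its expectation under
`θ = 0`, i.e. `μ* = sup_{θ0 ≤ 0} E_{θ0}[BF] = E_0[BF]`. -/
theorem expected_bayes_factor_maximized_at_zero
    (π : Measure ℝ) [IsProbabilityMeasure π]
    (hπ0 : 0 < π (Set.Iic (0 : ℝ))) (hπ1 : 0 < π (Set.Ioi (0 : ℝ)))
    (g : ℝ → ℝ → ℝ≥0∞) (hg_meas : Measurable (Function.uncurry g))
    (hg_fin : ∀ θ p, g θ p ≠ ⊤)
    (hg_dens : ∀ θ : ℝ, ∫⁻ p in Set.Icc (0 : ℝ) 1, g θ p = 1)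
    (hg_mono : ∀ θ : ℝ, θ ≤ 0 → MonotoneOn (g θ) (Set.Icc (0 : ℝ) 1))
    (hg_anti : ∀ θ : ℝ, 0 < θ → AntitoneOn (g θ) (Set.Icc (0 : ℝ) 1))
    (hg_zero : ∀ p ∈ Set.Icc (0 : ℝ) 1, g 0 p = 1)
    (BF : ℝ → ℝ≥0∞)
    (hBF : ∀ p : ℝ, BF p =
      ((∫⁻ θ in Set.Ioi (0 : ℝ), g θ p ∂π) / π (Set.Ioi (0 : ℝ))) /
      ((∫⁻ θ in Set.Iic (0 : ℝ), g θ p ∂π) / π (Set.Iic (0 : ℝ))))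
    (hden_pos : ∀ p : ℝ, 0 < ∫⁻ θ in Set.Iic (0 : ℝ), g θ p ∂π)
    (hBF_int : ∀ θ0 : ℝ, θ0 ≤ 0 → ∫⁻ p in Set.Icc (0 : ℝ) 1, BF p * g θ0 p ≠ ⊤) :
    ∀ θ0 : ℝ, θ0 ≤ 0 →
      ∫⁻ p in Set.Icc (0 : ℝ) 1, BF p * g θ0 p ≤ ∫⁻ p in Set.Icc (0 : ℝ) 1, BF p := by
  intro θ0 hθ0
  have hBF_anti : AntitoneOn BF (Set.Icc 0 1) := by
    intro x hx y hy hxy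
    rw [hBF, hBF]
    refine ENNReal.div_le_div (ENNReal.div_le_div_right ?_ _) (ENNReal.div_le_div_right ?_ _)
    · exact setLIntegral_mono' measurableSet_Ioi fun θ hθ ↦ hg_anti θ hθ hx hy hxy
    · exact setLIntegral_mono' measurableSet_Iic fun θ hθ ↦ hg_mono θ hθ hx hy hxy
  have hcheb := hBF_anti.lintegral_mul_mul_measure_le (μ := volume) measurableSet_Icc
    (hg_mono θ0 hθ0) (aemeasurable_restrict_of_antitoneOn measurableSet_Icc hBF_anti)
    (hg_meas.comp measurable_prodMk_left).aemeasurable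
  simpa [hg_dens] using hcheb
end

section
/- Let π be a probability measure on ℝ with π0 = π((−∞, 0]) > 0 and π1 = π((0, ∞)) > 0, and let g : ℝ × [0, 1] → [0, ∞) be jointly measurable with ∫_0^1 g(θ, p) dp = 1 for every θ, such that for every θ ≤ 0 the map p ↦ g(θ, p) is monotone nondecreasing on [0,1], for every θ > 0 the map p ↦ g(θ, p) is monotone nonincreasing on [0,1], and g(0, p) = 1 for all p ∈ [0, 1]. Define the reduced Bayes factor BF_0(p) = ∫_{(0,∞)} g(θ, p) dπ(θ) / π1. Then BF_0 is an e-variable for H0 : θ ≤ 0 versus H1 : θ > 0: for every θ0 ≤ 0, ∫_0^1 BF_0(p) g(θ0, p) dp ≤ 1. -/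
open MeasureTheory
open scoped ENNReal

/-- Chebyshev's integral inequality for functions that antivary on a measurable set. -/
theorem AntivaryOn.measure_mul_setLIntegral_mul_le {α : Type*} [MeasurableSpace α]
    {μ : Measure α} {s : Set α} {f h : α → ℝ≥0∞} (hs : MeasurableSet s)
    (hfh : AntivaryOn f h s) (hf : Measurable f) (hh : Measurable h) :
    μ s * ∫⁻ x in s, f x * h x ∂μ ≤ (∫⁻ x in s, f x ∂μ) * ∫⁻ x in s, h x ∂μ := by
  have mul_meas : Measurable fun x => f x * h x := hf.mul hh
  have pointwise : ∀ x ∈ s, ∀ y ∈ s, f x * h x + f y * h y ≤ f x * h y + f y * h x := by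
    intro x hx y hy
    rcases lt_trichotomy (h x) (h y) with hxy | hxy | hxy
    · exact ENNReal.mul_add_mul_le_mul_add_mul_of_le (hfh hx hy hxy) hxy.le
    · rw [hxy]
    · rw [add_comm (f x * h x), add_comm (f x * h y)]
      exact ENNReal.mul_add_mul_le_mul_add_mul_of_le (hfh hy hx hxy) hxy.le
  have double : ∫⁻ x in s, ∫⁻ y in s, (f x * h x + f y * h y) ∂μ ∂μ
      ≤ ∫⁻ x in s, ∫⁻ y in s, (f x * h y + f y * h x) ∂μ ∂μ :=
    setLIntegral_mono' hs fun x hx => setLIntegral_mono' hs fun y hy => pointwise x hx y hy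
  have inner_left (x : α) : ∫⁻ y in s, (f x * h x + f y * h y) ∂μ
      = f x * h x * μ s + ∫⁻ y in s, f y * h y ∂μ := by
    rw [lintegral_add_left measurable_const, setLIntegral_const]
  have inner_right (x : α) : ∫⁻ y in s, (f x * h y + f y * h x) ∂μ
      = f x * (∫⁻ y in s, h y ∂μ) + (∫⁻ y in s, f y ∂μ) * h x := by
    rw [lintegral_add_left (hh.const_mul _), lintegral_const_mul _ hh, lintegral_mul_const _ hf]
  simp_rw [inner_left, inner_right] at double
  rw [lintegral_add_left (mul_meas.mul_const _), lintegral_add_left (hf.mul_const _),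
    lintegral_mul_const _ mul_meas, lintegral_mul_const _ hf, lintegral_const_mul _ hh,
    setLIntegral_const, mul_comm _ (μ s), ← two_mul, ← two_mul] at double
  exact (ENNReal.mul_le_mul_iff_right two_ne_zero ENNReal.ofNat_ne_top).mp double

/-- Example 3 of the paper (reduction to a singleton): under the monotonicity conditions
(5)–(6) for densities on `[0,1]` with `g 0` the uniform density, the reduced Bayes factor
`BF_0(p) = ∫_{(0,∞)} g θ p dπ θ / π((0,∞))` is an e-variable for `H0 : θ ≤ 0`:
its expectation under every null parameter is at most one. -/
theorem reduced_bayes_factor_is_evariable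
    (π : Measure ℝ) [IsProbabilityMeasure π]
    (hπ0 : 0 < π (Set.Iic (0 : ℝ))) (hπ1 : 0 < π (Set.Ioi (0 : ℝ)))
    (g : ℝ → ℝ → ℝ≥0∞) (hg_meas : Measurable (Function.uncurry g))
    (hg_fin : ∀ θ p, g θ p ≠ ⊤)
    (hg_dens : ∀ θ : ℝ, ∫⁻ p in Set.Icc (0 : ℝ) 1, g θ p = 1)
    (hg_mono : ∀ θ : ℝ, θ ≤ 0 → MonotoneOn (g θ) (Set.Icc (0 : ℝ) 1))
    (hg_anti : ∀ θ : ℝ, 0 < θ → AntitoneOn (g θ) (Set.Icc (0 : ℝ) 1))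
    (hg_zero : ∀ p ∈ Set.Icc (0 : ℝ) 1, g 0 p = 1)
    (BF0 : ℝ → ℝ≥0∞)
    (hBF0 : ∀ p : ℝ, BF0 p = (∫⁻ θ in Set.Ioi (0 : ℝ), g θ p ∂π) / π (Set.Ioi (0 : ℝ))) :
    ∀ θ0 : ℝ, θ0 ≤ 0 → ∫⁻ p in Set.Icc (0 : ℝ) 1, BF0 p * g θ0 p ≤ 1 := by
  intro θ0 hθ0
  have section_meas (θ : ℝ) : Measurable (g θ) := hg_meas.comp measurable_prodMk_left
  have chebyshev (θ : ℝ) (hθ : 0 < θ) : ∫⁻ p in Set.Icc (0 : ℝ) 1, g θ p * g θ0 p ≤ 1 := by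
    have hle := ((hg_anti θ hθ).antivaryOn (hg_mono θ0 hθ0)).measure_mul_setLIntegral_mul_le
      (μ := volume) measurableSet_Icc (section_meas θ) (section_meas θ0)
    simpa [hg_dens] using hle
  have eval_meas (p : ℝ) : Measurable fun θ => g θ p := hg_meas.comp measurable_prodMk_right
  have joint_meas : Measurable (Function.uncurry fun p θ => g θ p * g θ0 p) :=
    (hg_meas.comp measurable_swap).mul ((section_meas θ0).comp measurable_fst)
  have integrand (p : ℝ) : BF0 p * g θ0 p
      = (∫⁻ θ in Set.Ioi (0 : ℝ), g θ p * g θ0 p ∂π) * (π (Set.Ioi (0 : ℝ)))⁻¹ := by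
    rw [hBF0, lintegral_mul_const _ (eval_meas p), div_eq_mul_inv,
      mul_right_comm]
  simp_rw [integrand]
  rw [lintegral_mul_const _ joint_meas.lintegral_prod_right,
    lintegral_lintegral_swap joint_meas.aemeasurable, ← div_eq_mul_inv]
  refine ENNReal.div_le_of_le_mul ?_
  calc ∫⁻ θ in Set.Ioi (0 : ℝ), ∫⁻ p in Set.Icc (0 : ℝ) 1, g θ p * g θ0 p ∂volume ∂π
      ≤ ∫⁻ _ in Set.Ioi (0 : ℝ), 1 ∂π := setLIntegral_mono' measurableSet_Ioi chebyshev
    _ = 1 * π (Set.Ioi (0 : ℝ)) := setLIntegral_const _ _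
end

section
/- In the Beta p-value model, let π be any probability measure on ℝ with π0 = π((−∞, 0]) > 0 and π1 = π((0, ∞)) > 0, and define BF(p) = (∫_{(0,∞)} g_θ(p) dπ(θ)/π1) / (∫_{(−∞,0]} g_θ(p) dπ(θ)/π0) for p ∈ [0, 1], assuming the denominator is strictly positive and both integrals are finite for every p ∈ (0, 1]. Then the map p ↦ BF(p) is monotone nonincreasing on (0, 1]. -/
open MeasureTheory

/-- The density of the p-variable in the Beta p-value model of Section 5:
`g θ p = (1 − θ) p^(−θ)` for `θ ≤ 0` (Beta(1 − θ, 1)) and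
`g θ p = (1 + θ)(1 − p)^θ` for `θ > 0` (Beta(1, 1 + θ)), for `p ∈ [0, 1]`. -/
noncomputable def gBeta (θ p : ℝ) : ℝ :=
  if θ ≤ 0 then (1 - θ) * p ^ (-θ) else (1 + θ) * (1 - p) ^ θ

/-- Under the null, `gBeta θ` is nondecreasing on `[0, ∞)`. -/
theorem gBeta_monotoneOn {θ : ℝ} (hθ : θ ≤ 0) : MonotoneOn (gBeta θ) (Set.Ici 0) := by
  intro p hp q _ hpq
  simp only [gBeta, if_pos hθ]
  exact mul_le_mul_of_nonneg_left (Real.rpow_le_rpow hp hpq (by linarith)) (by linarith)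

/-- Under the alternative, `gBeta θ` is nonincreasing on `(-∞, 1]`. -/
theorem gBeta_antitoneOn {θ : ℝ} (hθ : 0 < θ) : AntitoneOn (gBeta θ) (Set.Iic 1) := by
  intro p _ q hq hpq
  simp only [gBeta, if_neg hθ.not_ge]
  exact mul_le_mul_of_nonneg_left
    (Real.rpow_le_rpow (sub_nonneg.2 hq) (by linarith) hθ.le) (by linarith)

/-- Under the alternative, `gBeta θ` is nonnegative on `(-∞, 1]`. -/
theorem gBeta_nonneg_of_pos {θ p : ℝ} (hθ : 0 < θ) (hp : p ≤ 1) : 0 ≤ gBeta θ p := by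
  simp only [gBeta, if_neg hθ.not_ge]
  exact mul_nonneg (by linarith) (Real.rpow_nonneg (sub_nonneg.2 hp) θ)

/-- In the Beta p-value model, for any prior `π` giving positive mass to both hypotheses,
the Bayes factor `p ↦ BF(p)` is monotone nonincreasing on `(0, 1]`. -/
theorem beta_model_bayes_factor_antitone
    (π : Measure ℝ) [IsProbabilityMeasure π]
    (hπ0 : 0 < π (Set.Iic (0 : ℝ))) (hπ1 : 0 < π (Set.Ioi (0 : ℝ)))
    (BF : ℝ → ℝ)
    (hBF : ∀ p : ℝ, BF p =
      ((∫ θ in Set.Ioi (0 : ℝ), gBeta θ p ∂π) / (π (Set.Ioi (0 : ℝ))).toReal) /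
      ((∫ θ in Set.Iic (0 : ℝ), gBeta θ p ∂π) / (π (Set.Iic (0 : ℝ))).toReal))
    (hden_pos : ∀ p ∈ Set.Ioc (0 : ℝ) 1, 0 < ∫ θ in Set.Iic (0 : ℝ), gBeta θ p ∂π)
    (hden_int : ∀ p ∈ Set.Ioc (0 : ℝ) 1, IntegrableOn (fun θ => gBeta θ p) (Set.Iic (0 : ℝ)) π)
    (hnum_int : ∀ p ∈ Set.Ioc (0 : ℝ) 1, IntegrableOn (fun θ => gBeta θ p) (Set.Ioi (0 : ℝ)) π) :
    AntitoneOn BF (Set.Ioc (0 : ℝ) 1) := by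
  intro p hp q hq hpq
  rw [hBF, hBF]
  have hpos : 0 < (π (Set.Iic (0 : ℝ))).toReal :=
    ENNReal.toReal_pos hπ0.ne' (measure_ne_top π _)
  have hnum : ∫ θ in Set.Ioi (0 : ℝ), gBeta θ q ∂π ≤ ∫ θ in Set.Ioi (0 : ℝ), gBeta θ p ∂π :=
    setIntegral_mono_on (hnum_int q hq) (hnum_int p hp) measurableSet_Ioi
      fun θ hθ => gBeta_antitoneOn hθ hp.2 hq.2 hpq
  have hden : ∫ θ in Set.Iic (0 : ℝ), gBeta θ p ∂π ≤ ∫ θ in Set.Iic (0 : ℝ), gBeta θ q ∂π :=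
    setIntegral_mono_on (hden_int p hp) (hden_int q hq) measurableSet_Iic
      fun θ hθ => gBeta_monotoneOn hθ hp.1.le hq.1.le hpq
  have hnonneg : 0 ≤ ∫ θ in Set.Ioi (0 : ℝ), gBeta θ p ∂π :=
    setIntegral_nonneg measurableSet_Ioi fun θ hθ => gBeta_nonneg_of_pos hθ hp.2
  exact div_le_div₀ (div_nonneg hnonneg ENNReal.toReal_nonneg)
    (div_le_div_of_nonneg_right hnum ENNReal.toReal_nonneg)
    (div_pos (hden_pos p hp) hpos) (div_le_div_of_nonneg_right hden hpos.le)
end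

section
/- In the Beta p-value model, let π be any probability measure on ℝ with π0 = π((−∞, 0]) > 0 and π1 = π((0, ∞)) > 0, and define BF(p) = (∫_{(0,∞)} g_θ(p) dπ(θ)/π1) / (∫_{(−∞,0]} g_θ(p) dπ(θ)/π0), assuming the denominator is strictly positive, both integrals are finite for every p ∈ (0, 1], and BF is integrable under g_θ for every θ ≤ 0. Then the map θ ↦ E_θ[BF] = ∫_0^1 BF(p) g_θ(p) dp is monotone nondecreasing on (−∞, 0]. -/
open MeasureTheory

theorem gBeta_of_nonpos {θ : ℝ} (h : θ ≤ 0) (p : ℝ) :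
    gBeta θ p = (1 - θ) * p ^ (-θ) := if_pos h

theorem gBeta_of_pos {θ : ℝ} (h : 0 < θ) (p : ℝ) :
    gBeta θ p = (1 + θ) * (1 - p) ^ θ := if_neg h.not_ge

theorem gBeta_nonneg (θ : ℝ) {p : ℝ} (h0 : 0 ≤ p) (h1 : p ≤ 1) : 0 ≤ gBeta θ p := by
  rcases le_or_gt θ 0 with h | h
  · rw [gBeta_of_nonpos h]
    exact mul_nonneg (by linarith) (Real.rpow_nonneg h0 _)
  · rw [gBeta_of_pos h]
    exact mul_nonneg (by linarith) (Real.rpow_nonneg (by linarith) _)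

theorem gBeta_mono_of_nonpos {θ p q : ℝ} (h : θ ≤ 0) (hp : 0 ≤ p) (hpq : p ≤ q) :
    gBeta θ p ≤ gBeta θ q := by
  rw [gBeta_of_nonpos h, gBeta_of_nonpos h]
  exact mul_le_mul_of_nonneg_left (Real.rpow_le_rpow hp hpq (by linarith)) (by linarith)

theorem gBeta_anti_of_pos {θ p q : ℝ} (h : 0 < θ) (hpq : p ≤ q) (hq : q ≤ 1) :
    gBeta θ q ≤ gBeta θ p := by
  rw [gBeta_of_pos h, gBeta_of_pos h]
  exact mul_le_mul_of_nonneg_left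
    (Real.rpow_le_rpow (by linarith) (by linarith) h.le) (by linarith)

theorem integrableOn_gBeta {θ : ℝ} (h : θ ≤ 0) :
    IntegrableOn (gBeta θ) (Set.Ioc 0 1) := by
  rw [funext (gBeta_of_nonpos h)]
  exact ((intervalIntegral.intervalIntegrable_rpow'
    (by linarith : (-1 : ℝ) < -θ)).const_mul _).1

theorem setIntegral_gBeta {θ : ℝ} (h : θ ≤ 0) : ∫ p in Set.Ioc (0 : ℝ) 1, gBeta θ p = 1 := by
  rw [funext (gBeta_of_nonpos h), ← intervalIntegral.integral_of_le zero_le_one,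
    intervalIntegral.integral_const_mul, integral_rpow (Or.inl (by linarith)),
    Real.one_rpow, Real.zero_rpow (by linarith)]
  have : -θ + 1 ≠ 0 := by linarith
  field_simp
  ring

/-- Two null densities of the Beta model cross once on `(0, 1]`. -/
theorem exists_gBeta_crossing {s t : ℝ} (hst : s < t) (ht : t ≤ 0) :
    ∃ c ∈ Set.Ioc (0 : ℝ) 1, (∀ p, 0 < p → p ≤ c → gBeta s p ≤ gBeta t p) ∧
      ∀ p, c ≤ p → gBeta t p ≤ gBeta s p := by
  have hs : 0 < 1 - s := by linarith
  have ht' : 0 < 1 - t := by linarith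
  have hd : 0 < t - s := by linarith
  have hr : 0 < (1 - t) / (1 - s) := div_pos ht' hs
  have hc : 0 < ((1 - t) / (1 - s)) ^ (t - s)⁻¹ := Real.rpow_pos_of_pos hr _
  have hcd : (((1 - t) / (1 - s)) ^ (t - s)⁻¹) ^ (t - s) = (1 - t) / (1 - s) :=
    Real.rpow_inv_rpow hr.le hd.ne'
  have hsplit : ∀ p : ℝ, 0 < p → gBeta s p = p ^ (-t) * (p ^ (t - s) * (1 - s)) := by
    intro p hp
    rw [gBeta_of_nonpos (by linarith), ← mul_assoc, ← Real.rpow_add hp, mul_comm]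
    ring_nf
  refine ⟨_, ⟨hc, Real.rpow_le_one hr.le ((div_le_one hs).2 (by linarith))
    (inv_nonneg.2 hd.le)⟩, fun p hp hpc => ?_, fun p hcp => ?_⟩
  · rw [hsplit p hp, gBeta_of_nonpos ht, mul_comm (1 - t)]
    have h := Real.rpow_le_rpow hp.le hpc hd.le
    rw [hcd, le_div_iff₀ hs] at h
    exact mul_le_mul_of_nonneg_left h (Real.rpow_nonneg hp.le _)
  · have hp := hc.trans_le hcp
    rw [hsplit p hp, gBeta_of_nonpos ht, mul_comm (1 - t)]
    have h := Real.rpow_le_rpow hc.le hcp hd.le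
    rw [hcd, div_le_iff₀ hs] at h
    exact mul_le_mul_of_nonneg_left h (Real.rpow_nonneg hp.le _)

/-- Expectations of an antitone function under the null densities are monotone in `θ`. -/
theorem AntitoneOn.setIntegral_mul_gBeta_le {f : ℝ → ℝ} (hf : AntitoneOn f (Set.Ioc 0 1))
    {s t : ℝ} (hst : s < t) (ht : t ≤ 0)
    (his : IntegrableOn (fun p => f p * gBeta s p) (Set.Ioc 0 1))
    (hit : IntegrableOn (fun p => f p * gBeta t p) (Set.Ioc 0 1)) :
    ∫ p in Set.Ioc (0 : ℝ) 1, f p * gBeta s p ≤ ∫ p in Set.Ioc (0 : ℝ) 1, f p * gBeta t p := by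
  obtain ⟨c, hc, hle, hge⟩ := exists_gBeta_crossing hst ht
  have hs : s ≤ 0 := by linarith
  have his' := (integrableOn_gBeta hs).const_mul (f c)
  have hit' := (integrableOn_gBeta ht).const_mul (f c)
  have h : ∫ p in Set.Ioc (0 : ℝ) 1, (f p * gBeta s p - f c * gBeta s p) ≤
      ∫ p in Set.Ioc (0 : ℝ) 1, (f p * gBeta t p - f c * gBeta t p) := by
    refine setIntegral_mono_on (his.sub his') (hit.sub hit') measurableSet_Ioc fun p hp => ?_
    rcases le_total p c with hpc | hpc
    · nlinarith [hf hp hc hpc, hle p hp.1 hpc]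
    · nlinarith [hf hc hp hpc, hge p hpc]
  rw [integral_sub his his', integral_sub hit hit', integral_const_mul, integral_const_mul,
    setIntegral_gBeta hs, setIntegral_gBeta ht] at h
  linarith

/-- Monotonicity of the expected Bayes factor on the null hypothesis in the Beta p-value
model (illustrated in Table 1 of Section 5): the map
`θ ↦ E_θ[BF] = ∫_0^1 BF(p) g_θ(p) dp` is monotone nondecreasing on `(−∞, 0]`. -/
theorem beta_model_expected_bayes_factor_monotone
    (π : Measure ℝ) [IsProbabilityMeasure π]
    (hπ0 : 0 < π (Set.Iic (0 : ℝ))) (hπ1 : 0 < π (Set.Ioi (0 : ℝ)))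
    (BF : ℝ → ℝ)
    (hBF : ∀ p : ℝ, BF p =
      ((∫ θ in Set.Ioi (0 : ℝ), gBeta θ p ∂π) / (π (Set.Ioi (0 : ℝ))).toReal) /
      ((∫ θ in Set.Iic (0 : ℝ), gBeta θ p ∂π) / (π (Set.Iic (0 : ℝ))).toReal))
    (hden_pos : ∀ p ∈ Set.Ioc (0 : ℝ) 1, 0 < ∫ θ in Set.Iic (0 : ℝ), gBeta θ p ∂π)
    (hden_int : ∀ p ∈ Set.Ioc (0 : ℝ) 1, IntegrableOn (fun θ => gBeta θ p) (Set.Iic (0 : ℝ)) π)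
    (hnum_int : ∀ p ∈ Set.Ioc (0 : ℝ) 1, IntegrableOn (fun θ => gBeta θ p) (Set.Ioi (0 : ℝ)) π)
    (hBF_int : ∀ θ : ℝ, θ ≤ 0 →
      IntegrableOn (fun p => BF p * gBeta θ p) (Set.Icc (0 : ℝ) 1)) :
    MonotoneOn (fun θ => ∫ p in Set.Icc (0 : ℝ) 1, BF p * gBeta θ p)
      (Set.Iic (0 : ℝ)) := by
  have hanti : AntitoneOn BF (Set.Ioc 0 1) := by
    intro p hp q hq hpq
    have hnum : ∫ θ in Set.Ioi (0 : ℝ), gBeta θ q ∂π ≤ ∫ θ in Set.Ioi (0 : ℝ), gBeta θ p ∂π :=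
      setIntegral_mono_on (hnum_int q hq) (hnum_int p hp) measurableSet_Ioi
        fun θ hθ => gBeta_anti_of_pos hθ hpq hq.2
    have hden : ∫ θ in Set.Iic (0 : ℝ), gBeta θ p ∂π ≤ ∫ θ in Set.Iic (0 : ℝ), gBeta θ q ∂π :=
      setIntegral_mono_on (hden_int p hp) (hden_int q hq) measurableSet_Iic
        fun θ hθ => gBeta_mono_of_nonpos hθ hp.1.le hpq
    have hnonneg : 0 ≤ ∫ θ in Set.Ioi (0 : ℝ), gBeta θ p ∂π :=
      integral_nonneg fun θ => gBeta_nonneg θ hp.1.le hp.2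
    have hmass : 0 < (π (Set.Iic (0 : ℝ))).toReal :=
      ENNReal.toReal_pos hπ0.ne' (measure_ne_top _ _)
    rw [hBF, hBF]
    have := hden_pos p hp
    gcongr
  intro s hs t ht hst
  rcases hst.eq_or_lt with rfl | hlt
  · exact le_rfl
  · simp only [integral_Icc_eq_integral_Ioc]
    exact hanti.setIntegral_mul_gBeta_le hlt ht
      ((hBF_int s hs).mono_set Set.Ioc_subset_Icc_self)
      ((hBF_int t ht).mono_set Set.Ioc_subset_Icc_self)
end
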